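/- arXiv:1803.01433 — 9 statements merged into one kernel-verified Lean document; each statement's English description precedes it below -/
import Mathlib

section
/- Let m ≥ 2 and n ≥ 1, and let A be an mth-order n-dimensional strictly semi-positive real tensor. Then for every q ∈ ℝⁿ, the solution set of the tensor complementarity problem TCP(A,q), i.e. the set {x ∈ ℝⁿ : x ≥ 0, A x^{m-1} + q ≥ 0, ⟨x, A x^{m-1} + q⟩ = 0}, is nonempty and compact. -/
open Finset Filter

/-- `A x^{m-1}`: the vector whose `i`-th entry is the sum over all tuples of the
remaining `r = m-1` indices of the tensor entry times the product of components of `x`. -/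
noncomputable def tApply {n r : ℕ} (A : Fin n → (Fin r → Fin n) → ℝ) (x : Fin n → ℝ) :
    Fin n → ℝ :=
  fun i => ∑ j : Fin r → Fin n, A i j * ∏ k, x (j k)

/-- A tensor is strictly semi-positive if for every nonzero nonnegative `x` there is an
index `i` with `x i > 0` and `(A x^{m-1}) i > 0`. -/
def StrictlySemiPositive {n r : ℕ} (A : Fin n → (Fin r → Fin n) → ℝ) : Prop :=
  ∀ x : Fin n → ℝ, (∀ i, 0 ≤ x i) → x ≠ 0 → ∃ i, 0 < x i ∧ 0 < tApply A x i

/-- `f` is a P-function on the nonnegative orthant: for distinct nonnegative `x, y`,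
`max_i (x_i - y_i)(f_i(x) - f_i(y)) > 0`. -/
def PFunctionOn {n : ℕ} (f : (Fin n → ℝ) → Fin n → ℝ) : Prop :=
  ∀ x y : Fin n → ℝ, (∀ i, 0 ≤ x i) → (∀ i, 0 ≤ y i) → x ≠ y →
    ∃ i, 0 < (x i - y i) * (f x i - f y i)

/-- A tensor is strong strictly semi-positive if `x ↦ A x^{m-1} + q` is a P-function
on the nonnegative orthant for every `q`. -/
def StrongStrictlySemiPositive {n r : ℕ} (A : Fin n → (Fin r → Fin n) → ℝ) : Prop :=
  ∀ q : Fin n → ℝ, PFunctionOn (fun x i => tApply A x i + q i)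

/-- The solution set of the tensor complementarity problem TCP(A, q). -/
noncomputable def TCPSol {n r : ℕ} (A : Fin n → (Fin r → Fin n) → ℝ) (q : Fin n → ℝ) :
    Set (Fin n → ℝ) :=
  {x | (∀ i, 0 ≤ x i) ∧ (∀ i, 0 ≤ tApply A x i + q i) ∧
    ∑ i, x i * (tApply A x i + q i) = 0}

/-- A finite set `S` is dominant for the orders induced by the `w i` if no point lies strictly
above the minimum of `S` in all of these orders. -/
def Dominant {V I : Type*} (w : I → V → ℕ) (S : Finset V) : Prop :=
  ∀ y, ∃ i, ∀ s ∈ S, w i y ≤ w i s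

/-- `y` is maximal for the `i`-th order among the points lying strictly above the minimum of `τ`
in all the other orders. -/
def IsPivot {V I : Type*} (w : I → V → ℕ) (τ : Finset V) (i : I) (y : V) : Prop :=
  (∀ l, l ≠ i → ∃ s ∈ τ, w l s < w l y) ∧
    ∀ z, (∀ l, l ≠ i → ∃ s ∈ τ, w l s < w l z) → w i z ≤ w i y

theorem Dominant.mono {V I : Type*} {w : I → V → ℕ} {S T : Finset V} (hS : Dominant w S)
    (h : T ⊆ S) : Dominant w T := fun y => by
  obtain ⟨i, hi⟩ := hS y
  exact ⟨i, fun s hs => hi s (h hs)⟩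

theorem IsPivot.eq {V I : Type*} {w : I → V → ℕ} (hw : ∀ i, Function.Injective (w i))
    {τ : Finset V} {i : I} {y z : V} (hy : IsPivot w τ i y) (hz : IsPivot w τ i z) : y = z :=
  hw i (le_antisymm (hz.2 y hy.1) (hy.2 z hz.1))

theorem exists_isPivot {V I : Type*} [Finite V] {w : I → V → ℕ} {τ : Finset V} {i : I}
    (h : ∃ y, ∀ l, l ≠ i → ∃ s ∈ τ, w l s < w l y) : ∃ y, IsPivot w τ i y := by
  obtain ⟨y, hy, hmax⟩ := Set.exists_max_image
    {y | ∀ l, l ≠ i → ∃ s ∈ τ, w l s < w l y} (w i) (Set.toFinite _) h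
  exact ⟨y, hy, hmax⟩

theorem IsPivot.not_mem {V I : Type*} {w : I → V → ℕ} {τ : Finset V} (hτ : Dominant w τ)
    {i j : I} (hij : i ≠ j) {x : V} (hi : ∀ s ∈ τ, w i x ≤ w i s)
    (hj : ∀ s ∈ τ, w j x ≤ w j s) (hw : ∀ i, Function.Injective (w i)) (hx : x ∈ τ)
    {y : V} (hy : IsPivot w τ i y) : y ∉ τ := by
  intro hyτ
  obtain ⟨l, hl⟩ := hτ y
  have hli : l = i := by
    by_contra h
    obtain ⟨s, hs, hlt⟩ := hy.1 l h
    exact absurd (hl s hs) (not_le.2 hlt)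
  subst hli
  have hyx : y = x := hw l (le_antisymm (hl x hx) (hi y hyτ))
  subst hyx
  obtain ⟨s, hs, hlt⟩ := hy.1 j hij.symm
  exact absurd (hj s hs) (not_le.2 hlt)

theorem IsPivot.dominant_insert {V I : Type*} [DecidableEq V] {w : I → V → ℕ} {τ : Finset V}
    (hτ : Dominant w τ) {i : I} {y : V} (hy : IsPivot w τ i y) : Dominant w (insert y τ) := by
  intro z
  by_contra! h
  have hz : ∀ l, l ≠ i → ∃ s ∈ τ, w l s < w l z := by
    intro l hl
    obtain ⟨s, hs, hlt⟩ := h l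
    rcases Finset.mem_insert.1 hs with rfl | hs
    · obtain ⟨s', hs', hlt'⟩ := hy.1 l hl
      exact ⟨s', hs', hlt'.trans hlt⟩
    · exact ⟨s, hs, hlt⟩
  obtain ⟨s, hs, hlt⟩ := h i
  rcases Finset.mem_insert.1 hs with rfl | hs
  · exact absurd (hy.2 z hz) (not_le.2 hlt)
  obtain ⟨l, hl⟩ := hτ z
  by_cases hli : l = i
  · subst hli
    exact absurd (hl s hs) (not_le.2 hlt)
  · obtain ⟨s', hs', hlt'⟩ := hz l hli
    exact absurd (hl s' hs') (not_le.2 hlt')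

theorem Dominant.exists_isPivot {V I : Type*} [DecidableEq V] [Fintype I]
    {w : I → V → ℕ} (hw : ∀ i, Function.Injective (w i)) {τ : Finset V}
    (hcard : τ.card + 1 = Fintype.card I) {y : V} (hy : y ∉ τ)
    (hdom : Dominant w (insert y τ)) {i j : I} (hij : i ≠ j) {x : V} (hx : x ∈ τ)
    (hi : ∀ s ∈ τ, w i x ≤ w i s) (hj : ∀ s ∈ τ, w j x ≤ w j s) :
    IsPivot w τ i y ∨ IsPivot w τ j y := by
  have hex : ∀ l, ∃ b : (insert y τ : Finset V), ∀ s ∈ insert y τ, w l b ≤ w l s := by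
    intro l
    obtain ⟨b, hb, hmin⟩ := Finset.exists_min_image (insert y τ) (w l) ⟨y, by simp⟩
    exact ⟨⟨b, hb⟩, hmin⟩
  choose b hb using hex
  have hsurj : Function.Surjective b := by
    rintro ⟨s, hs⟩
    obtain ⟨l, hl⟩ := hdom s
    exact ⟨l, Subtype.ext (hw l (le_antisymm (hb l s hs) (hl _ (b l).2)))⟩
  have hbij : Function.Bijective b := by
    rw [Fintype.bijective_iff_surjective_and_card]
    refine ⟨hsurj, ?_⟩
    rw [Fintype.card_coe, Finset.card_insert_of_notMem hy, hcard]
  obtain ⟨k, hk⟩ := hsurj ⟨y, by simp⟩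
  have hne : ∀ l, l ≠ k → (b l : V) ∈ τ := by
    intro l hl
    rcases Finset.mem_insert.1 (b l).2 with h | h
    · exact absurd (hbij.1 ((Subtype.ext h : b l = ⟨y, by simp⟩).trans hk.symm)) hl
    · exact h
  have hbx : ∀ l, l ≠ k → (∀ s ∈ τ, w l x ≤ w l s) → (b l : V) = x := fun l hl h =>
    hw l (le_antisymm (hb l x (Finset.mem_insert_of_mem hx)) (h _ (hne l hl)))
  have hpivot : IsPivot w τ k y := by
    constructor
    · intro l hl
      refine ⟨b l, hne l hl, lt_of_le_of_ne (hb l y (by simp)) fun h => hy ?_⟩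
      rw [← hw l h]
      exact hne l hl
    · intro z hz
      obtain ⟨l, hl⟩ := hdom z
      by_cases hlk : l = k
      · subst hlk
        exact hl y (by simp)
      · obtain ⟨s, hs, hlt⟩ := hz l hlk
        exact absurd (hl s (Finset.mem_insert_of_mem hs)) (not_le.2 hlt)
  by_cases hki : i = k
  · exact Or.inl (hki ▸ hpivot)
  by_cases hkj : j = k
  · exact Or.inr (hkj ▸ hpivot)
  · exact absurd (hbij.1 (Subtype.ext ((hbx i hki hi).trans (hbx j hkj hj).symm))) hij

open Classical in
theorem even_card_dominant_insert {V I : Type*} [Fintype V] [DecidableEq V] [Fintype I]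
    {w : I → V → ℕ} (hw : ∀ i, Function.Injective (w i)) {τ : Finset V}
    (hcard : τ.card + 1 = Fintype.card I) (hne : τ.Nonempty)
    (hM : ∀ i, ∃ y, ∀ l, l ≠ i → ∃ s ∈ τ, w l s < w l y) :
    Even (Finset.univ.filter fun y => y ∉ τ ∧ Dominant w (insert y τ)).card := by
  by_cases hτ : Dominant w τ
  swap
  · rw [Finset.filter_false_of_mem]
    · simp
    · exact fun y _ h => hτ (h.2.mono (Finset.subset_insert _ _))
  have hex : ∀ l, ∃ a : τ, ∀ s ∈ τ, w l a ≤ w l s := by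
    intro l
    obtain ⟨b, hb, hmin⟩ := Finset.exists_min_image τ (w l) hne
    exact ⟨⟨b, hb⟩, hmin⟩
  choose a ha using hex
  obtain ⟨i, j, hij, haij⟩ := Fintype.exists_ne_map_eq_of_card_lt a (by
    rw [Fintype.card_coe]; omega)
  have haj := ha j
  rw [← haij] at haj
  obtain ⟨yi, hyi⟩ := exists_isPivot (hM i)
  obtain ⟨yj, hyj⟩ := exists_isPivot (hM j)
  have hyne : yi ≠ yj := by
    rintro rfl
    obtain ⟨l, hl⟩ := hτ yi
    have : ∃ s ∈ τ, w l s < w l yi := by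
      by_cases hli : l = i
      · exact hyj.1 l (hli ▸ hij)
      · exact hyi.1 l hli
    obtain ⟨s, hs, hlt⟩ := this
    exact absurd (hl s hs) (not_le.2 hlt)
  have : (Finset.univ.filter fun y => y ∉ τ ∧ Dominant w (insert y τ)) = {yi, yj} := by
    ext y
    simp only [mem_filter, mem_univ, true_and, mem_insert, mem_singleton]
    constructor
    · rintro ⟨h1, h2⟩
      rcases h2.exists_isPivot hw hcard h1 hij (a i).2 (ha i) haj with h | h
      · exact Or.inl (h.eq hw hyi)
      · exact Or.inr (h.eq hw hyj)
    · rintro (rfl | rfl)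
      · exact ⟨hyi.not_mem hτ hij (ha i) haj hw (a i).2, hyi.dominant_insert hτ⟩
      · exact ⟨hyj.not_mem hτ hij.symm haj (ha i) hw (a i).2, hyj.dominant_insert hτ⟩
  rw [this, Finset.card_pair hyne]
  exact even_two

theorem even_card_erase_image {V I : Type*} [DecidableEq V] [Fintype I] [DecidableEq I]
    (c : V → I) (i₀ : I) {S : Finset V} (hcard : S.card = Fintype.card I)
    (hS : S.image c ≠ Finset.univ) :
    Even (S.filter fun x => (S.erase x).image c = Finset.univ.erase i₀).card := by
  rcases (S.filter fun x => (S.erase x).image c = Finset.univ.erase i₀).eq_empty_or_nonempty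
    with h | h
  · simp [h]
  obtain ⟨x, hx⟩ := h
  obtain ⟨hxS, hx⟩ := Finset.mem_filter.1 hx
  have hinj : Set.InjOn c (S.erase x : Finset V) := by
    rw [← Finset.card_image_iff, hx, Finset.card_erase_of_mem hxS, hcard,
      Finset.card_erase_of_mem (mem_univ _), Finset.card_univ]
  have hcx : c x ≠ i₀ := by
    intro h
    apply hS
    rw [← Finset.insert_erase hxS, Finset.image_insert, hx, h, Finset.insert_erase (mem_univ _)]
  obtain ⟨x', hx'S, hx'⟩ := Finset.mem_image.1
    (hx ▸ Finset.mem_erase.2 ⟨hcx, mem_univ _⟩ : c x ∈ (S.erase x).image c)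
  have hne : x' ≠ x := (Finset.mem_erase.1 hx'S).1
  have hx'S' : x' ∈ S := (Finset.mem_erase.1 hx'S).2
  have : (S.filter fun x => (S.erase x).image c = Finset.univ.erase i₀) = {x, x'} := by
    ext z
    simp only [mem_filter, mem_insert, mem_singleton]
    constructor
    · rintro ⟨hzS, hz⟩
      by_contra! hzx
      have hzinj : Set.InjOn c (S.erase z : Finset V) := by
        rw [← Finset.card_image_iff, hz, Finset.card_erase_of_mem hzS, hcard,
          Finset.card_erase_of_mem (mem_univ _), Finset.card_univ]
      exact hne (hzinj (by simp [hx'S', hzx.2.symm]) (by simp [hxS, hzx.1.symm]) hx')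
    · rintro (rfl | rfl)
      · exact ⟨hxS, hx⟩
      · refine ⟨hx'S', ?_⟩
        rw [← hx]
        ext l
        simp only [mem_image, mem_erase]
        constructor
        · rintro ⟨v, ⟨hv, hvS⟩, rfl⟩
          by_cases hvx : v = x
          · exact ⟨z, ⟨hne, hx'S'⟩, by rw [hvx, hx']⟩
          · exact ⟨v, ⟨hvx, hvS⟩, rfl⟩
        · rintro ⟨v, ⟨hv, hvS⟩, rfl⟩
          by_cases hvx : v = z
          · exact ⟨x, ⟨hne.symm, hxS⟩, by rw [hvx, hx']⟩
          · exact ⟨v, ⟨hvx, hvS⟩, rfl⟩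
  rw [this, Finset.card_pair hne.symm]
  exact even_two

open Classical in
theorem sum_card_erase_eq_sum_card_insert {V I : Type*} [Fintype V] [DecidableEq V]
    [Fintype I] [DecidableEq I] (w : I → V → ℕ) (c : V → I) (i₀ : I) (n : ℕ) :
    ∑ S : Finset V with S.card = n + 1 ∧ Dominant w S,
        (S.filter fun x => (S.erase x).image c = Finset.univ.erase i₀).card =
      ∑ τ : Finset V with τ.card = n ∧ τ.image c = Finset.univ.erase i₀,
        (Finset.univ.filter fun y => y ∉ τ ∧ Dominant w (insert y τ)).card := by
  rw [← Finset.card_sigma, ← Finset.card_sigma]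
  refine Finset.card_bij' (fun p _ => ⟨p.1.erase p.2, p.2⟩) (fun p _ => ⟨insert p.2 p.1, p.2⟩)
    ?_ ?_ ?_ ?_
  · rintro ⟨S, x⟩ h
    simp only [mem_sigma, mem_filter, mem_univ, true_and] at h ⊢
    obtain ⟨⟨h1, h2⟩, h3, h4⟩ := h
    refine ⟨⟨by rw [Finset.card_erase_of_mem h3, h1]; rfl, h4⟩, by simp, ?_⟩
    rwa [Finset.insert_erase h3]
  · rintro ⟨τ, y⟩ h
    simp only [mem_sigma, mem_filter, mem_univ, true_and] at h ⊢
    obtain ⟨⟨h1, h2⟩, h3, h4⟩ := h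
    refine ⟨⟨by rw [Finset.card_insert_of_notMem h3, h1], h4⟩, by simp, ?_⟩
    rwa [Finset.erase_insert h3]
  · rintro ⟨S, x⟩ h
    simp only [mem_sigma, mem_filter, mem_univ, true_and] at h
    simp [Finset.insert_erase h.2.1]
  · rintro ⟨τ, y⟩ h
    simp only [mem_sigma, mem_filter, mem_univ, true_and] at h
    simp [Finset.erase_insert h.2.1]

/-- The combinatorial lemma of Scarf. The elements `Sum.inr i` play the role of slack vectors. -/
theorem exists_dominant_image_eq_univ {T I : Type*} [Fintype T] [Fintype I] [Nonempty T]
    [Nonempty I] [DecidableEq I] (w : I → T ⊕ I → ℕ) (hw : ∀ i, Function.Injective (w i))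
    (hlow : ∀ i v, w i (Sum.inr i) ≤ w i v)
    (hhigh : ∀ i j t, j ≠ i → w i (Sum.inl t) < w i (Sum.inr j)) (c : T → I) :
    ∃ S : Finset (T ⊕ I), Dominant w S ∧ S.image (Sum.elim c id) = Finset.univ := by
  classical
  by_contra! hno
  obtain ⟨i₀⟩ := ‹Nonempty I›
  obtain ⟨n, hn⟩ : ∃ n, Fintype.card I = n + 1 :=
    Nat.exists_eq_succ_of_ne_zero (Fintype.card_ne_zero (α := I))
  have hsum := sum_card_erase_eq_sum_card_insert w (Sum.elim c id) i₀ n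
  have heven : Even (∑ S : Finset (T ⊕ I) with S.card = n + 1 ∧ Dominant w S,
      (S.filter fun x => (S.erase x).image (Sum.elim c id) = Finset.univ.erase i₀).card) := by
    refine Finset.even_sum _ fun S hS => ?_
    obtain ⟨h1, h2⟩ := (Finset.mem_filter.1 hS).2
    exact even_card_erase_image (Sum.elim c id) i₀ (h1.trans hn.symm) (hno S h2)
  set τ₀ : Finset (T ⊕ I) := (Finset.univ.erase i₀).image Sum.inr with hτ₀
  have hτ₀inr : ∀ i, Sum.inr i ∈ τ₀ ↔ i ≠ i₀ := by simp [hτ₀]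
  have hτ₀inl : ∀ t, Sum.inl t ∉ τ₀ := by simp [hτ₀]
  have hτ₀mem : τ₀ ∈ Finset.univ.filter fun τ : Finset (T ⊕ I) =>
      τ.card = n ∧ τ.image (Sum.elim c id) = Finset.univ.erase i₀ := by
    simp only [mem_filter, mem_univ, true_and]
    constructor
    · rw [hτ₀, Finset.card_image_of_injective _ Sum.inr_injective,
        Finset.card_erase_of_mem (mem_univ _), Finset.card_univ, hn]
      rfl
    · rw [hτ₀, Finset.image_image]
      ext i
      simp
  have hone : (Finset.univ.filter fun y => y ∉ τ₀ ∧ Dominant w (insert y τ₀)).card = 1 := by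
    obtain ⟨t, -, ht⟩ := Finset.exists_max_image (Finset.univ : Finset T)
      (fun t => w i₀ (Sum.inl t)) Finset.univ_nonempty
    rw [Finset.card_eq_one]
    refine ⟨Sum.inl t, ?_⟩
    ext y
    simp only [mem_filter, mem_univ, true_and, mem_singleton]
    constructor
    · rintro ⟨hy, hdom⟩
      obtain ⟨l, hl⟩ := hdom (Sum.inl t)
      have hlow' : ∀ i, w i (Sum.inr i) < w i (Sum.inl t) := fun i =>
        lt_of_le_of_ne (hlow i _) fun h => by simpa using hw i h
      have hli : l = i₀ := by
        by_contra h
        exact absurd (hl (Sum.inr l) (by simp [hτ₀inr, h])) (not_le.2 (hlow' l))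
      subst hli
      have hy' := hl y (by simp)
      rcases y with s | i
      · exact hw l (le_antisymm (ht s (mem_univ _)) hy')
      · have : i = l := by
          by_contra h
          exact hy ((hτ₀inr i).2 h)
        subst this
        exact absurd hy' (not_le.2 (hlow' i))
    · rintro rfl
      refine ⟨hτ₀inl t, ?_⟩
      rintro (s | i)
      · refine ⟨i₀, fun v hv => ?_⟩
        rcases Finset.mem_insert.1 hv with rfl | hv
        · exact ht s (mem_univ _)
        · rcases v with v | v
          · exact absurd hv (hτ₀inl v)
          · exact (hhigh _ _ _ ((hτ₀inr v).1 hv)).le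
      · exact ⟨i, fun v _ => hlow i v⟩
  rw [hsum, ← Finset.add_sum_erase _ _ hτ₀mem, hone] at heven
  have hrest : Even (∑ τ ∈ (Finset.univ.filter fun τ : Finset (T ⊕ I) =>
      τ.card = n ∧ τ.image (Sum.elim c id) = Finset.univ.erase i₀).erase τ₀,
        (Finset.univ.filter fun y => y ∉ τ ∧ Dominant w (insert y τ)).card) := by
    refine Finset.even_sum _ fun τ hτ => ?_
    obtain ⟨hne, hτ⟩ := Finset.mem_erase.1 hτ
    obtain ⟨h1, h2⟩ := (Finset.mem_filter.1 hτ).2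
    obtain ⟨t, ht⟩ : ∃ t, Sum.inl t ∈ τ := by
      by_contra! h
      refine hne ?_
      ext v
      rcases v with v | v
      · simp [h, hτ₀inl]
      · rw [hτ₀inr]
        constructor
        · intro hv
          have : v ∈ τ.image (Sum.elim c id) := Finset.mem_image.2 ⟨_, hv, rfl⟩
          rw [h2] at this
          exact (Finset.mem_erase.1 this).1
        · intro hv
          have : v ∈ τ.image (Sum.elim c id) := by simp [h2, hv]
          obtain ⟨u, hu, huv⟩ := Finset.mem_image.1 this
          rcases u with u | u
          · exact absurd hu (h u)
          · simpa [← show u = v from huv] using hu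
    exact even_card_dominant_insert hw (by omega) ⟨_, ht⟩ fun i =>
      ⟨Sum.inr i, fun l hl => ⟨_, ht, hhigh l i t hl.symm⟩⟩
  rw [Nat.even_add] at heven
  exact absurd (heven.2 hrest) (by decide)

/-- The points of the `N`-th grid subdivision of the simplex, scaled to integer coordinates. -/
abbrev SimplexGrid (I : Type*) [Fintype I] (N : ℕ) : Type _ :=
  {x : I → Fin (N + 1) // ∑ i, (x i : ℕ) = N}

/-- Heights of grid points and slack vectors. -/
def gridHeight {I : Type*} [Fintype I] [DecidableEq I] (N : ℕ) (i : I) :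
    SimplexGrid I N ⊕ I → ℕ :=
  Sum.elim (fun x => x.1 i + 1) fun j => if j = i then 0 else N + 2

/-- Every labelling of the grid has a near-solution: a grid point `x` such that each `i` either
has small coordinate at `x` or is the label of some point near `x`. -/
theorem exists_simplexGrid_near {I : Type*} [Fintype I] [Nonempty I] (N : ℕ)
    (c : SimplexGrid I N → I) :
    ∃ x : SimplexGrid I N, ∀ i, (x.1 i : ℕ) ≤ Fintype.card I ∨
      ∃ y : SimplexGrid I N, c y = i ∧
        ∀ l, (y.1 l : ℕ) ≤ x.1 l + Fintype.card I ∧ (x.1 l : ℕ) ≤ y.1 l + Fintype.card I := by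
  classical
  obtain ⟨i₁⟩ := ‹Nonempty I›
  have hmk : ∀ g : I → ℕ, ∑ i, g i = N → ∃ x : SimplexGrid I N, ∀ i, (x.1 i : ℕ) = g i := by
    intro g hg
    have hle : ∀ i, g i ≤ N := fun i =>
      hg ▸ Finset.single_le_sum (fun _ _ => Nat.zero_le _) (mem_univ i)
    exact ⟨⟨fun i => ⟨g i, Nat.lt_succ_of_le (hle i)⟩, hg⟩, fun i => rfl⟩
  have : Nonempty (SimplexGrid I N) :=
    ⟨(hmk (Pi.single i₁ N) (by simp)).choose⟩
  set M := Fintype.card (SimplexGrid I N ⊕ I)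
  let e := Fintype.equivFin (SimplexGrid I N ⊕ I)
  let w : I → SimplexGrid I N ⊕ I → ℕ := fun i v => gridHeight N i v * M + e v
  have hwlt : ∀ i u v, gridHeight N i u < gridHeight N i v → w i u < w i v := by
    intro i u v h
    have h1 : (e u : ℕ) < M := (e u).2
    have h2 : (gridHeight N i u + 1) * M ≤ gridHeight N i v * M := Nat.mul_le_mul_right _ h
    simp only [w]
    linarith
  have hw : ∀ i, Function.Injective (w i) := by
    intro i u v h
    have hh : gridHeight N i u = gridHeight N i v := by
      rcases lt_trichotomy (gridHeight N i u) (gridHeight N i v) with h' | h' | h'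
      · exact absurd h (hwlt i u v h').ne
      · exact h'
      · exact absurd h (hwlt i v u h').ne'
    simp only [w, hh] at h
    exact e.injective (Fin.ext (by omega))
  obtain ⟨S, hdom, himg⟩ := exists_dominant_image_eq_univ w hw (by
      rintro i (t | j)
      · exact (hwlt _ _ _ (by simp [gridHeight])).le
      · by_cases h : j = i
        · rw [h]
        · exact (hwlt _ _ _ (by simp [gridHeight, h])).le) (by
      intro i j t h
      refine hwlt _ _ _ ?_
      have := (t.1 i).2
      simp only [gridHeight, Sum.elim_inl, Sum.elim_inr, h, if_false]
      omega) c
  set C : Finset I := Finset.univ.filter fun i => Sum.inr i ∉ S with hC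
  have hlabel : ∀ i ∈ C, ∃ x : SimplexGrid I N, Sum.inl x ∈ S ∧ c x = i := by
    intro i hi
    obtain ⟨v, hv, hvi⟩ := Finset.mem_image.1 (himg ▸ mem_univ i)
    rcases v with x | j
    · exact ⟨x, hv, hvi⟩
    · obtain rfl : j = i := hvi
      exact absurd hv (Finset.mem_filter.1 hi).2
  have hnot : ∀ y : SimplexGrid I N, ∃ i ∈ C, ∀ x, Sum.inl x ∈ S → (y.1 i : ℕ) ≤ x.1 i := by
    intro y
    obtain ⟨i, hi⟩ := hdom (Sum.inl y)
    refine ⟨i, ?_, fun x hx => ?_⟩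
    · rw [hC, Finset.mem_filter]
      refine ⟨mem_univ _, fun h => ?_⟩
      exact absurd (hi _ h) (not_le.2 (hwlt _ _ _ (by simp [gridHeight])))
    · by_contra! h
      exact absurd (hi _ hx) (not_le.2 (hwlt _ _ _ (by simpa [gridHeight] using h)))
  obtain ⟨i₂, hi₂, -⟩ := hnot (Classical.arbitrary _)
  obtain ⟨x₀, hx₀, -⟩ := hlabel i₂ hi₂
  have hmin : ∀ l, ∃ a : ℕ, (∀ x, Sum.inl x ∈ S → a ≤ x.1 l) ∧
      ∃ x, Sum.inl x ∈ S ∧ (x.1 l : ℕ) = a := by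
    intro l
    obtain ⟨x, hx, hxmin⟩ := Set.exists_min_image {x : SimplexGrid I N | Sum.inl x ∈ S}
      (fun x => (x.1 l : ℕ)) (Set.toFinite _) ⟨x₀, hx₀⟩
    exact ⟨x.1 l, hxmin, x, hx, rfl⟩
  choose a ha ha' using hmin
  have hsum : N < ∑ l ∈ C, (a l + 1) := by
    by_contra! h
    obtain ⟨y, hy⟩ := hmk (fun l => (if l ∈ C then a l + 1 else 0) +
      if l = i₁ then N - ∑ l ∈ C, (a l + 1) else 0) (by
        rw [Finset.sum_add_distrib, Finset.sum_ite_mem, Finset.univ_inter, Finset.sum_ite_eq']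
        simp only [mem_univ, if_true]
        omega)
    obtain ⟨i, hi, hle⟩ := hnot y
    obtain ⟨x, hx, hxa⟩ := ha' i
    have h1 := hle x hx
    rw [hy i, if_pos hi] at h1
    omega
  rw [Finset.sum_add_distrib, Finset.sum_const, smul_eq_mul, mul_one] at hsum
  have hCcard : C.card ≤ Fintype.card I := Finset.card_le_univ C
  have hbound : ∀ x : SimplexGrid I N, Sum.inl x ∈ S →
      (∀ l ∈ C, (x.1 l : ℕ) ≤ a l + Fintype.card I) ∧
      ∀ l, l ∉ C → (x.1 l : ℕ) ≤ Fintype.card I := by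
    intro x hx
    have hx1 := x.2
    rw [← Finset.sum_add_sum_compl C] at hx1
    constructor
    · intro l hl
      have h2 : ∑ k ∈ C.erase l, a k ≤ ∑ k ∈ C.erase l, (x.1 k : ℕ) :=
        Finset.sum_le_sum fun k _ => ha k x hx
      have h3 := Finset.add_sum_erase C a hl
      have h4 := Finset.add_sum_erase C (fun k => (x.1 k : ℕ)) hl
      omega
    · intro l hl
      have h2 : ∑ k ∈ C, a k ≤ ∑ k ∈ C, (x.1 k : ℕ) :=
        Finset.sum_le_sum fun k _ => ha k x hx
      have h3 : (x.1 l : ℕ) ≤ ∑ k ∈ Cᶜ, (x.1 k : ℕ) :=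
        Finset.single_le_sum (f := fun k => (x.1 k : ℕ)) (fun _ _ => Nat.zero_le _)
          (Finset.mem_compl.2 hl)
      omega
  refine ⟨x₀, fun i => ?_⟩
  by_cases hi : i ∈ C
  · obtain ⟨y, hyS, hy⟩ := hlabel i hi
    refine Or.inr ⟨y, hy, fun l => ?_⟩
    by_cases hl : l ∈ C
    · have h1 := (hbound y hyS).1 l hl
      have h2 := (hbound x₀ hx₀).1 l hl
      have h3 := ha l y hyS
      have h4 := ha l x₀ hx₀
      omega
    · have h1 := (hbound y hyS).2 l hl
      have h2 := (hbound x₀ hx₀).2 l hl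
      omega
  · exact Or.inl ((hbound x₀ hx₀).2 i hi)

/-- Existence of solutions of variational inequalities on the standard simplex. -/
theorem exists_stdSimplex_variational {I : Type*} [Fintype I] [Nonempty I]
    {F : (I → ℝ) → I → ℝ} (hF : Continuous F) :
    ∃ z ∈ stdSimplex ℝ I, ∀ i, z i ≠ 0 → ∀ j, F z i ≤ F z j := by
  let p : ∀ N : ℕ, SimplexGrid I (N + 1) → I → ℝ := fun N x i => (x.1 i : ℕ) / ((N : ℝ) + 1)
  have hp : ∀ N x, p N x ∈ stdSimplex ℝ I := by
    intro N x
    refine ⟨fun i => by positivity, ?_⟩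
    have h := x.2
    have hN : (N : ℝ) + 1 ≠ 0 := by positivity
    simp only [p]
    rw [← Finset.sum_div, ← Nat.cast_sum, h]
    push_cast
    exact div_self hN
  have hc : ∀ N x, ∃ i, ∀ j, F (p N x) i ≤ F (p N x) j := fun N x => Finite.exists_min _
  choose c hc using hc
  choose x hx using fun N => exists_simplexGrid_near (N + 1) (c N)
  obtain ⟨z, hz, φ, hφ, hlim⟩ := (isCompact_stdSimplex ℝ I).tendsto_subseq
    (fun N => hp N (x N))
  refine ⟨z, hz, fun i hi j => ?_⟩
  by_contra! hlt
  have hopen : IsOpen {u | F u j < F u i} :=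
    isOpen_lt ((continuous_apply j).comp hF) ((continuous_apply i).comp hF)
  obtain ⟨ε, hε, hball⟩ := Metric.isOpen_iff.1 hopen z hlt
  have hzi : 0 < z i := lt_of_le_of_ne (hz.1 i) hi.symm
  have hsmall : Tendsto (fun k => (Fintype.card I : ℝ) / ((φ k : ℝ) + 1)) atTop (nhds 0) :=
    ((tendsto_const_div_atTop_nhds_zero_nat (Fintype.card I : ℝ)).comp
      ((tendsto_add_atTop_nat 1).comp hφ.tendsto_atTop)).congr fun k => by simp
  have hlimi : Tendsto (fun k => p (φ k) (x (φ k)) i) atTop (nhds (z i)) :=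
    (tendsto_pi_nhds.1 hlim) i
  have h1 := hsmall.eventually (gt_mem_nhds (half_pos hε))
  have h2 := hsmall.eventually (gt_mem_nhds (half_pos hzi))
  have h3 := hlimi.eventually (lt_mem_nhds (half_lt_self hzi))
  have h4 := hlim.eventually (Metric.ball_mem_nhds z (half_pos hε))
  obtain ⟨k, h1, h2, h3, h4⟩ := (h1.and (h2.and (h3.and h4))).exists
  have hpos : (0 : ℝ) < (φ k : ℝ) + 1 := by positivity
  rcases hx (φ k) i with h | ⟨y, hy, hyx⟩
  · have : p (φ k) (x (φ k)) i ≤ (Fintype.card I : ℝ) / ((φ k : ℝ) + 1) := by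
      simp only [p]
      gcongr
    linarith
  · have hdist : dist (p (φ k) y) (p (φ k) (x (φ k))) ≤
        (Fintype.card I : ℝ) / ((φ k : ℝ) + 1) := by
      refine (dist_pi_le_iff (by positivity)).2 fun l => ?_
      have ha : ((y.1 l : ℕ) : ℝ) ≤ (((x (φ k)).1 l : ℕ) : ℝ) + Fintype.card I := by
        exact_mod_cast (hyx l).1
      have hb : (((x (φ k)).1 l : ℕ) : ℝ) ≤ ((y.1 l : ℕ) : ℝ) + Fintype.card I := by
        exact_mod_cast (hyx l).2
      simp only [p]
      rw [Real.dist_eq, ← sub_div, abs_div, abs_of_pos hpos]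
      gcongr
      rw [abs_le]
      constructor <;> linarith
    have hmem : p (φ k) y ∈ Metric.ball z ε := by
      rw [Metric.mem_ball]
      have := dist_triangle (p (φ k) y) (p (φ k) (x (φ k))) z
      have h4' : dist (p (φ k) (x (φ k))) z < ε / 2 := h4
      linarith
    have hlt' : F (p (φ k) y) j < F (p (φ k) y) i := hball hmem
    have := hc (φ k) y j
    rw [hy] at this
    linarith

theorem continuous_tApply {n r : ℕ} (A : Fin n → (Fin r → Fin n) → ℝ) :
    Continuous (tApply A) := by
  unfold tApply
  fun_prop

theorem tApply_smul {n r : ℕ} (A : Fin n → (Fin r → Fin n) → ℝ) (t : ℝ) (x : Fin n → ℝ)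
    (i : Fin n) : tApply A (t • x) i = t ^ r * tApply A x i := by
  simp only [tApply, Finset.mul_sum, Pi.smul_apply, smul_eq_mul, Finset.prod_mul_distrib,
    Finset.prod_const, Finset.card_univ, Fintype.card_fin]
  exact Finset.sum_congr rfl fun j _ => by ring

/-- A priori bound: for a strictly semi-positive tensor the nonnegative vectors `x` with
`A x^{m-1} + q` nonpositive on the support of `x` form a bounded set. -/
theorem StrictlySemiPositive.exists_norm_le {n r : ℕ} (hr : r ≠ 0)
    {A : Fin n → (Fin r → Fin n) → ℝ} (hA : StrictlySemiPositive A) (q : Fin n → ℝ) :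
    ∃ B : ℝ, 0 ≤ B ∧ ∀ x : Fin n → ℝ, (∀ i, 0 ≤ x i) →
      (∀ i, 0 < x i → tApply A x i + q i ≤ 0) → ‖x‖ ≤ B := by
  have hcont : Continuous fun u : Fin n → ℝ => ∑ i, u i * max 0 (tApply A u i) := by
    have := continuous_tApply A
    fun_prop
  have hK : IsCompact ({u : Fin n → ℝ | ∀ i, 0 ≤ u i} ∩ Metric.sphere 0 1) := by
    refine (isCompact_sphere _ _).inter_left ?_
    simp only [Set.ofPred_forall]
    exact isClosed_iInter fun i => isClosed_le continuous_const (continuous_apply i)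
  obtain ⟨a, ha, hmin⟩ := hK.exists_forall_le' hcont.continuousOn (a := 0) (by
    rintro u ⟨hu, hu1⟩
    have hu0 : u ≠ 0 := by
      rintro rfl
      simp at hu1
    obtain ⟨i, hi, hAi⟩ := hA u hu hu0
    exact Finset.sum_pos' (fun j _ => mul_nonneg (hu j) (le_max_left _ _))
      ⟨i, Finset.mem_univ i, mul_pos hi (lt_max_of_lt_right hAi)⟩)
  refine ⟨max 1 ((∑ i, |q i|) / a), by positivity, fun x hx hxq => ?_⟩
  by_contra! hlt
  have h1 : 1 < ‖x‖ := (le_max_left _ _).trans_lt hlt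
  have h2 : (∑ i, |q i|) / a < ‖x‖ := (le_max_right _ _).trans_lt hlt
  have hpos : 0 < ‖x‖ := one_pos.trans h1
  set u : Fin n → ℝ := ‖x‖⁻¹ • x with hu
  have hxu : x = ‖x‖ • u := by rw [hu, smul_inv_smul₀ hpos.ne']
  have hu0 : ∀ i, 0 ≤ u i := fun i => mul_nonneg (inv_nonneg.2 hpos.le) (hx i)
  have hu1 : ‖u‖ = 1 := by rw [hu, norm_smul, norm_inv, norm_norm, inv_mul_cancel₀ hpos.ne']
  have hg := hmin u ⟨hu0, by simpa using hu1⟩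
  have hle : ‖x‖ ^ r * ∑ i, u i * max 0 (tApply A u i) ≤ ∑ i, |q i| := by
    rw [Finset.mul_sum]
    refine Finset.sum_le_sum fun i _ => ?_
    rcases (hu0 i).eq_or_lt with h | h
    · simp [← h]
    · have hxi : 0 < x i := by
        rw [hxu]
        exact mul_pos hpos h
      have hq := hxq i hxi
      rw [show tApply A x i = ‖x‖ ^ r * tApply A u i by
        rw [← tApply_smul, ← hxu]] at hq
      have hui : u i ≤ 1 := (le_abs_self _).trans ((norm_le_pi_norm u i).trans hu1.le)
      have hmax : ‖x‖ ^ r * max 0 (tApply A u i) ≤ |q i| := by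
        rw [mul_max_of_nonneg _ _ (by positivity), mul_zero]
        exact max_le (abs_nonneg _) (by linarith [neg_le_abs (q i)])
      calc ‖x‖ ^ r * (u i * max 0 (tApply A u i))
          = u i * (‖x‖ ^ r * max 0 (tApply A u i)) := by ring
        _ ≤ 1 * |q i| := by gcongr
        _ = |q i| := one_mul _
  have hpow : ‖x‖ ≤ ‖x‖ ^ r := le_self_pow₀ h1.le hr
  rw [div_lt_iff₀ ha] at h2
  have : ‖x‖ * a ≤ ‖x‖ ^ r * ∑ i, u i * max 0 (tApply A u i) := by gcongr
  linarith

theorem isClosed_TCPSol {n r : ℕ} (A : Fin n → (Fin r → Fin n) → ℝ) (q : Fin n → ℝ) :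
    IsClosed (TCPSol A q) := by
  have hA : ∀ i, Continuous fun x => tApply A x i := fun i =>
    (continuous_apply i).comp (continuous_tApply A)
  simp only [TCPSol, Set.ofPred_and, Set.ofPred_forall]
  refine (isClosed_iInter fun i => isClosed_le continuous_const (continuous_apply i)).inter
    ((isClosed_iInter fun i => isClosed_le continuous_const (by fun_prop)).inter
      (isClosed_eq (by fun_prop) continuous_const))

theorem StrictlySemiPositive.nonempty_TCPSol {n r : ℕ} (hr : r ≠ 0)
    {A : Fin n → (Fin r → Fin n) → ℝ} (hA : StrictlySemiPositive A) (q : Fin n → ℝ) :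
    (TCPSol A q).Nonempty := by
  obtain ⟨B, hB0, hB⟩ := hA.exists_norm_le hr q
  set R : ℝ := n * B + 1 with hR
  have hRpos : 0 < R := by positivity
  let F : (Option (Fin n) → ℝ) → Option (Fin n) → ℝ := fun z o =>
    o.elim 0 fun i => tApply A (fun k => R * z (some k)) i + q i
  have hF : Continuous F := by
    refine continuous_pi fun o => ?_
    rcases o with _ | i
    · exact continuous_const
    · have hscale : Continuous fun (z : Option (Fin n) → ℝ) (k : Fin n) => R * z (some k) := by
        fun_prop
      have h : Continuous fun z : Option (Fin n) → ℝ =>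
          tApply A (fun k => R * z (some k)) i :=
        (continuous_apply i).comp ((continuous_tApply A).comp hscale)
      exact h.add continuous_const
  obtain ⟨z, ⟨hz0, hz1⟩, hz⟩ := exists_stdSimplex_variational hF
  have hx0 : ∀ i, 0 ≤ R * z (some i) := fun i => mul_nonneg hRpos.le (hz0 _)
  have hle : ∀ i, z (some i) ≠ 0 → tApply A (fun k => R * z (some k)) i + q i ≤ 0 :=
    fun i hi => hz (some i) hi none
  by_cases hnone : z none = 0
  · have hnorm := hB (fun k => R * z (some k)) hx0 fun i hi =>
      hle i (right_ne_zero_of_mul hi.ne')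
    have hsum : R * ∑ i, z (some i) ≤ n * B := by
      rw [Finset.mul_sum]
      have := Finset.sum_le_card_nsmul Finset.univ (fun i => R * z (some i)) B fun i _ =>
        (le_abs_self _).trans ((norm_le_pi_norm (fun k => R * z (some k)) i).trans hnorm)
      simpa using this
    rw [Fintype.sum_option, hnone, zero_add] at hz1
    rw [hz1] at hsum
    linarith
  · have hge : ∀ i, 0 ≤ tApply A (fun k => R * z (some k)) i + q i := fun i =>
      hz none hnone (some i)
    refine ⟨fun k => R * z (some k), hx0, hge, Finset.sum_eq_zero fun i _ => ?_⟩
    by_cases hi : z (some i) = 0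
    · simp [hi]
    · rw [le_antisymm (hle i hi) (hge i), mul_zero]

theorem StrictlySemiPositive.isCompact_TCPSol {n r : ℕ} (hr : r ≠ 0)
    {A : Fin n → (Fin r → Fin n) → ℝ} (hA : StrictlySemiPositive A) (q : Fin n → ℝ) :
    IsCompact (TCPSol A q) := by
  obtain ⟨B, -, hB⟩ := hA.exists_norm_le hr q
  refine Metric.isCompact_of_isClosed_isBounded (isClosed_TCPSol A q)
    (isBounded_iff_forall_norm_le.2 ⟨B, ?_⟩)
  rintro x ⟨h0, h1, h2⟩
  refine hB x h0 fun i hi => ?_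
  have := (Finset.sum_eq_zero_iff_of_nonneg fun i _ => mul_nonneg (h0 i) (h1 i)).1 h2 i
    (Finset.mem_univ i)
  exact ((mul_eq_zero.1 this).resolve_left hi.ne').le

theorem tcp_strictly_semipositive_nonempty_compact
    (m n : ℕ) (hm : 2 ≤ m) (hn : 1 ≤ n)
    (A : Fin n → (Fin (m - 1) → Fin n) → ℝ)
    (hA : StrictlySemiPositive A) (q : Fin n → ℝ) :
    (TCPSol A q).Nonempty ∧ IsCompact (TCPSol A q) :=
  have hr : m - 1 ≠ 0 := by omega
  ⟨hA.nonempty_TCPSol hr q, hA.isCompact_TCPSol hr q⟩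
end

section
/- Let m ≥ 2 and n ≥ 1, and let A be an mth-order n-dimensional strictly semi-positive real tensor. Then the function x ↦ max_{1 ≤ i ≤ n} x_i (A x^{m-1})_i attains a minimum value β(A) on the compact set {x ∈ ℝⁿ : x ≥ 0, ‖x‖_∞ = 1}, and β(A) > 0. -/
open Finset Filter

/-- `max_{1 ≤ i ≤ n} x_i (A x^{m-1})_i`. -/
noncomputable def maxTerm {n r : ℕ} (hn : 0 < n) (A : Fin n → (Fin r → Fin n) → ℝ)
    (x : Fin n → ℝ) : ℝ :=
  Finset.univ.sup' (Finset.univ_nonempty_iff.mpr ⟨⟨0, hn⟩⟩) (fun i => x i * tApply A x i)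

theorem continuous_maxTerm {n r : ℕ} (hn : 0 < n) (A : Fin n → (Fin r → Fin n) → ℝ) :
    Continuous (maxTerm hn A) := by
  unfold maxTerm
  refine Continuous.finset_sup'_apply _ fun i _ => ?_
  exact (continuous_apply i).mul ((continuous_apply i).comp (continuous_tApply A))

theorem StrictlySemiPositive.maxTerm_pos {n r : ℕ} (hn : 0 < n)
    {A : Fin n → (Fin r → Fin n) → ℝ} (hA : StrictlySemiPositive A) {x : Fin n → ℝ}
    (hx : ∀ i, 0 ≤ x i) (hx0 : x ≠ 0) : 0 < maxTerm hn A x := by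
  obtain ⟨i, hi, hAi⟩ := hA x hx hx0
  exact (Finset.lt_sup'_iff _).mpr ⟨i, Finset.mem_univ i, mul_pos hi hAi⟩

theorem isCompact_nonneg_unit_sphere (n : ℕ) :
    IsCompact {x : Fin n → ℝ | (∀ i, 0 ≤ x i) ∧ ‖x‖ = 1} := by
  have hclosed : IsClosed {x : Fin n → ℝ | ∀ i, 0 ≤ x i} := by
    simp only [Set.ofPred_forall]
    exact isClosed_iInter fun i => isClosed_le continuous_const (continuous_apply i)
  have heq : {x : Fin n → ℝ | (∀ i, 0 ≤ x i) ∧ ‖x‖ = 1} =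
      {x : Fin n → ℝ | ∀ i, 0 ≤ x i} ∩ Metric.sphere 0 1 := by
    ext x
    simp
  rw [heq]
  exact (isCompact_sphere (0 : Fin n → ℝ) 1).inter_left hclosed

theorem nonneg_unit_sphere_nonempty {n : ℕ} (hn : 0 < n) :
    {x : Fin n → ℝ | (∀ i, 0 ≤ x i) ∧ ‖x‖ = 1}.Nonempty := by
  have : Nonempty (Fin n) := ⟨⟨0, hn⟩⟩
  exact ⟨fun _ => 1, fun _ => zero_le_one, by simp [pi_norm_const]⟩

theorem beta_attained_and_positive
    (m n : ℕ) (hm : 2 ≤ m) (hn : 0 < n)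
    (A : Fin n → (Fin (m - 1) → Fin n) → ℝ)
    (hA : StrictlySemiPositive A) :
    IsCompact {x : Fin n → ℝ | (∀ i, 0 ≤ x i) ∧ ‖x‖ = 1} ∧
    ∃ β : ℝ, 0 < β ∧
      (∃ x : Fin n → ℝ, ((∀ i, 0 ≤ x i) ∧ ‖x‖ = 1) ∧ maxTerm hn A x = β) ∧
      (∀ x : Fin n → ℝ, (∀ i, 0 ≤ x i) → ‖x‖ = 1 → β ≤ maxTerm hn A x) := by
  have hK := isCompact_nonneg_unit_sphere n
  obtain ⟨x, hx, hmin⟩ := hK.exists_isMinOn (nonneg_unit_sphere_nonempty hn)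
    (continuous_maxTerm hn A).continuousOn
  have hx0 : x ≠ 0 := by
    rintro rfl
    simp at hx
  exact ⟨hK, maxTerm hn A x, hA.maxTerm_pos hn hx.1 hx0, ⟨x, hx, rfl⟩,
    fun y hy hy1 => hmin ⟨hy, hy1⟩⟩
end

section
/- Let m ≥ 2 and n ≥ 1, let A be an mth-order n-dimensional real tensor, q ∈ ℝⁿ, a ∈ ℝⁿ with a ≥ 0, b ∈ ℝⁿ with b > 0, and define H(x,y,t) ∈ ℝ²ⁿ by H(x,y,t) = (x₁y₁ − t a₁, …, xₙyₙ − t aₙ, y − (1−t)(A x^{m-1} + q) − t b). Suppose (x^k, y^k, t_k) are such that x^k ≥ 0, y^k ≥ 0, t_k ∈ (0,1], H(x^k, y^k, t_k) = 0 for all k, t_k → 0, and (x^k, y^k) → (x*, y*). Then y* = A (x*)^{m-1} + q and x* solves TCP(A,q), i.e., x* ≥ 0, A (x*)^{m-1} + q ≥ 0, and ⟨x*, A (x*)^{m-1} + q⟩ = 0. -/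
open Finset Filter

theorem trajectory_limit_point_solves_tcp
    (m n : ℕ) (hm : 2 ≤ m) (hn : 1 ≤ n)
    (A : Fin n → (Fin (m - 1) → Fin n) → ℝ)
    (q a b : Fin n → ℝ) (ha : ∀ i, 0 ≤ a i) (hb : ∀ i, 0 < b i)
    (x y : ℕ → Fin n → ℝ) (t : ℕ → ℝ)
    (hx : ∀ k i, 0 ≤ x k i) (hy : ∀ k i, 0 ≤ y k i)
    (ht : ∀ k, t k ∈ Set.Ioc (0 : ℝ) 1)
    (hH1 : ∀ k i, x k i * y k i = t k * a i)
    (hH2 : ∀ k i, y k i = (1 - t k) * (tApply A (x k) i + q i) + t k * b i)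
    (ht0 : Tendsto t atTop (nhds 0))
    (xs ys : Fin n → ℝ)
    (hconv : Tendsto (fun k => (x k, y k)) atTop (nhds (xs, ys))) :
    (∀ i, ys i = tApply A xs i + q i) ∧
    (∀ i, 0 ≤ xs i) ∧ (∀ i, 0 ≤ tApply A xs i + q i) ∧
    ∑ i, xs i * (tApply A xs i + q i) = 0 := by
  have hxk (i : Fin n) : Tendsto (fun k => x k i) atTop (nhds (xs i)) :=
    hconv.fst_nhds.apply_nhds i
  have hyk (i : Fin n) : Tendsto (fun k => y k i) atTop (nhds (ys i)) :=
    hconv.snd_nhds.apply_nhds i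
  have hAk (i : Fin n) : Tendsto (fun k => tApply A (x k) i) atTop (nhds (tApply A xs i)) :=
    (((continuous_tApply A).tendsto xs).comp hconv.fst_nhds).apply_nhds i
  have hys (i : Fin n) : ys i = tApply A xs i + q i := by
    have h := ((ht0.const_sub 1).mul ((hAk i).add_const (q i))).add (ht0.mul_const (b i))
    simp only [← hH2, sub_zero, one_mul, zero_mul, add_zero] at h
    exact tendsto_nhds_unique (hyk i) h
  have hxy (i : Fin n) : xs i * ys i = 0 := by
    have h := (hxk i).mul (hyk i)
    simp only [hH1] at h
    simpa using tendsto_nhds_unique h (ht0.mul_const (a i))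
  refine ⟨hys, fun i => ge_of_tendsto' (hxk i) fun k => hx k i, fun i => ?_, ?_⟩
  · rw [← hys i]
    exact ge_of_tendsto' (hyk i) fun k => hy k i
  · exact Finset.sum_eq_zero fun i _ => by rw [← hys i, hxy i]
end

section
/- Let n ≥ 1 and let f : ℝⁿ → ℝⁿ be continuously differentiable and a P-function on ℝ₊ⁿ. Then for every x ∈ ℝⁿ with x > 0 componentwise, the Jacobian matrix Df(x) is a P₀ matrix. -/
open Finset Filter

/-- `M` is a P₀ matrix: for every nonzero `x` there is `i` with `x i ≠ 0` and
`x_i (M x)_i ≥ 0`. -/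
def IsP0Matrix {n : ℕ} (M : Matrix (Fin n) (Fin n) ℝ) : Prop :=
  ∀ x : Fin n → ℝ, x ≠ 0 → ∃ i, x i ≠ 0 ∧ 0 ≤ x i * M.mulVec x i

/-- If no coordinate of `L v` weakly agrees in sign with a nonzero coordinate of `v`, then moving
from `x` a short way along `v` does not increase any `v i * f i`. -/
theorem eventually_mul_sub_nonpos_of_hasFDerivAt {ι : Type*} [Fintype ι] {f : (ι → ℝ) → ι → ℝ}
    {L : (ι → ℝ) →L[ℝ] ι → ℝ} {x v : ι → ℝ} (hf : HasFDerivAt f L x)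
    (hv : ∀ i, v i ≠ 0 → v i * L v i < 0) :
    ∀ᶠ t : ℝ in nhdsWithin 0 (Set.Ioi 0), ∀ i, v i * (f (x + t • v) i - f x i) ≤ 0 := by
  rw [eventually_all]
  intro i
  by_cases hi : v i = 0
  · simp [hi]
  have hline : HasDerivAt (fun t : ℝ => v i * f (x + t • v) i) (v i * L v i) 0 :=
    (hasDerivAt_pi.1 (hf.hasLineDerivAt v) i).const_mul (v i)
  have hslope := (hasDerivAt_iff_tendsto_slope.1 hline).mono_left
    (nhdsWithin_mono 0 fun t (ht : 0 < t) => ht.ne')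
  filter_upwards [hslope.eventually_lt_const (hv i hi), self_mem_nhdsWithin] with t ht ht0
  rw [slope_def_field, div_lt_iff₀ (by simpa using ht0)] at ht
  simp only [zero_smul, add_zero, zero_mul] at ht
  linarith

theorem jacobian_of_P_function_is_P0
    (n : ℕ) (hn : 1 ≤ n) (f : (Fin n → ℝ) → Fin n → ℝ)
    (hf : ContDiff ℝ 1 f) (hP : PFunctionOn f)
    (x : Fin n → ℝ) (hx : ∀ i, 0 < x i) :
    IsP0Matrix (Matrix.of fun i j => fderiv ℝ f x (Pi.single j 1) i) := by
  intro v hv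
  by_contra! hneg
  have hmul (i : Fin n) : (Matrix.of fun i j => fderiv ℝ f x (Pi.single j 1) i).mulVec v i =
      fderiv ℝ f x v i := by
    conv_rhs => rw [pi_eq_sum_univ' v]
    simp [Matrix.mulVec, dotProduct, mul_comm]
  simp only [hmul] at hneg
  have hdecr := eventually_mul_sub_nonpos_of_hasFDerivAt
    (hf.differentiable one_ne_zero x).hasFDerivAt hneg
  have hpos : ∀ᶠ t : ℝ in nhdsWithin 0 (Set.Ioi 0), ∀ i, 0 < (x + t • v) i := by
    rw [eventually_all]
    intro i
    have hcont : Continuous fun t : ℝ => (x + t • v) i := by fun_prop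
    exact (hcont.continuousAt.eventually_const_lt (by simpa using hx i)).filter_mono
      nhdsWithin_le_nhds
  obtain ⟨t, hd, hp, ht⟩ := (hdecr.and (hpos.and self_mem_nhdsWithin)).exists
  have ht : 0 < t := ht
  obtain ⟨i, hi⟩ := hP (x + t • v) x (fun i => (hp i).le) (fun i => (hx i).le)
    (by simpa [ht.ne'] using hv)
  have hrw : ((x + t • v) i - x i) * (f (x + t • v) i - f x i) =
      t * (v i * (f (x + t • v) i - f x i)) := by
    simp only [Pi.add_apply, Pi.smul_apply, smul_eq_mul]
    ring
  rw [hrw] at hi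
  exact absurd (mul_nonpos_of_nonneg_of_nonpos ht.le (hd i)) hi.not_ge
end

section
/- Let n ≥ 1, let M ∈ ℝ^{n×n} be a P₀ matrix, and let D ∈ ℝ^{n×n} be a diagonal matrix with strictly positive diagonal entries. Then det(D + M) ≠ 0, i.e., D + M is nonsingular. -/
open Finset Filter

theorem pos_diagonal_add_P0_nonsingular
    (n : ℕ) (hn : 1 ≤ n) (M : Matrix (Fin n) (Fin n) ℝ) (hM : IsP0Matrix M)
    (d : Fin n → ℝ) (hd : ∀ i, 0 < d i) :
    (Matrix.diagonal d + M).det ≠ 0 := by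
  intro h
  obtain ⟨x, hx, hx0⟩ := Matrix.exists_mulVec_eq_zero_iff.mpr h
  obtain ⟨i, hi, hMi⟩ := hM x hx
  have hrow : d i * x i + M.mulVec x i = 0 := by
    simpa [Matrix.add_mulVec, Matrix.mulVec_diagonal] using congrFun hx0 i
  have hpos : 0 < d i * x i ^ 2 := mul_pos (hd i) (sq_pos_of_ne_zero hi)
  have hsum : d i * x i ^ 2 + x i * M.mulVec x i = 0 := by
    linear_combination x i * hrow
  linarith
end

section
/- Let n ≥ 1, let u, v ∈ ℝⁿ have all entries strictly positive, and let M ∈ ℝ^{n×n} be a P₀ matrix. Then the 2n × 2n block matrix [[diag(v), diag(u)], [−M, Iₙ]] is nonsingular; indeed its determinant equals det(diag(v)·diag(u)^{-1} + M) · det(diag(u)) ≠ 0. -/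
open Finset Filter

/-- Adding a positive diagonal to a P₀ matrix gives a nonsingular matrix. -/
theorem IsP0Matrix.det_diagonal_add_ne_zero {n : ℕ} {M : Matrix (Fin n) (Fin n) ℝ}
    (hM : IsP0Matrix M) {d : Fin n → ℝ} (hd : ∀ i, 0 < d i) :
    (Matrix.diagonal d + M).det ≠ 0 := by
  intro hdet
  obtain ⟨x, hx, hMx⟩ := Matrix.exists_mulVec_eq_zero_iff.mpr hdet
  obtain ⟨i, hi, hxi⟩ := hM x hx
  have hrow : d i * x i + M.mulVec x i = 0 := by
    simpa [Matrix.add_mulVec, Matrix.mulVec_diagonal] using congrFun hMx i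
  nlinarith [mul_pos (hd i) (mul_self_pos.mpr hi), congrArg (x i * ·) hrow]

theorem block_matrix_nonsingular
    (n : ℕ) (hn : 1 ≤ n) (u v : Fin n → ℝ)
    (hu : ∀ i, 0 < u i) (hv : ∀ i, 0 < v i)
    (M : Matrix (Fin n) (Fin n) ℝ) (hM : IsP0Matrix M) :
    (Matrix.fromBlocks (Matrix.diagonal v) (Matrix.diagonal u) (-M)
        (1 : Matrix (Fin n) (Fin n) ℝ)).det =
      (Matrix.diagonal v * (Matrix.diagonal u)⁻¹ + M).det * (Matrix.diagonal u).det ∧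
    (Matrix.fromBlocks (Matrix.diagonal v) (Matrix.diagonal u) (-M)
        (1 : Matrix (Fin n) (Fin n) ℝ)).det ≠ 0 := by
  have hinv : Matrix.diagonal v * (Matrix.diagonal u)⁻¹ = Matrix.diagonal (fun i => v i / u i) := by
    have hmul : Matrix.diagonal u * Matrix.diagonal (fun i => (u i)⁻¹) = 1 := by
      simp [Matrix.diagonal_mul_diagonal, (hu _).ne']
    rw [Matrix.inv_eq_right_inv hmul, Matrix.diagonal_mul_diagonal]
    simp only [div_eq_mul_inv]
  have hfactor : Matrix.diagonal v - Matrix.diagonal u * -M =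
      Matrix.diagonal u * (Matrix.diagonal (fun i => v i / u i) + M) := by
    rw [Matrix.mul_add, Matrix.diagonal_mul_diagonal, Matrix.mul_neg, sub_neg_eq_add]
    simp only [mul_div_cancel₀ _ (hu _).ne']
  have hdet : (Matrix.fromBlocks (Matrix.diagonal v) (Matrix.diagonal u) (-M)
        (1 : Matrix (Fin n) (Fin n) ℝ)).det =
      (Matrix.diagonal v * (Matrix.diagonal u)⁻¹ + M).det * (Matrix.diagonal u).det := by
    rw [Matrix.det_fromBlocks_one₂₂, hfactor, hinv, Matrix.det_mul, mul_comm]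
  refine ⟨hdet, ?_⟩
  rw [hdet, hinv, Matrix.det_diagonal]
  exact mul_ne_zero (hM.det_diagonal_add_ne_zero fun i => div_pos (hv i) (hu i))
    (Finset.prod_ne_zero_iff.mpr fun i _ => (hu i).ne')
end

section
/- Let n ≥ 1 and let f : ℝⁿ → ℝⁿ be a P-function on ℝ₊ⁿ. Then the complementarity problem for f has at most one solution: if x and y both satisfy the conditions z ≥ 0, f(z) ≥ 0, ⟨z, f(z)⟩ = 0, then x = y. -/
open Finset Filter

theorem P_function_cp_unique_solution
    (n : ℕ) (hn : 1 ≤ n) (f : (Fin n → ℝ) → Fin n → ℝ) (hP : PFunctionOn f)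
    (x y : Fin n → ℝ)
    (hxsol : (∀ i, 0 ≤ x i) ∧ (∀ i, 0 ≤ f x i) ∧ ∑ i, x i * f x i = 0)
    (hysol : (∀ i, 0 ≤ y i) ∧ (∀ i, 0 ≤ f y i) ∧ ∑ i, y i * f y i = 0) :
    x = y := by
  obtain ⟨hx, hfx, hxs⟩ := hxsol
  obtain ⟨hy, hfy, hys⟩ := hysol
  by_contra hne
  obtain ⟨i, hi⟩ := hP x y hx hy hne
  have hxi : x i * f x i = 0 :=
    (sum_eq_zero_iff_of_nonneg fun j _ => mul_nonneg (hx j) (hfx j)).1 hxs i (mem_univ i)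
  have hyi : y i * f y i = 0 :=
    (sum_eq_zero_iff_of_nonneg fun j _ => mul_nonneg (hy j) (hfy j)).1 hys i (mem_univ i)
  linarith [mul_nonneg (hx i) (hfy i), mul_nonneg (hy i) (hfx i),
    show (x i - y i) * (f x i - f y i) =
      x i * f x i - x i * f y i - y i * f x i + y i * f y i by ring]
end

section
/- Let A be the 3rd-order 2-dimensional real tensor with entries a₁₁₁ = 1, a₁₂₁ = 1, a₁₂₂ = −1, a₂₂₂ = 1, a₂₁₁ = −1, a₂₂₁ = 1, and all other entries 0, so that for x ∈ ℝ², A x² = (x₁² + x₁x₂ − x₂², x₂² + x₁x₂ − x₁²). Then A is strong strictly semi-positive: for every q ∈ ℝ², the map x ↦ A x² + q is a P-function on ℝ₊². -/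
open Finset Filter

/-- The 3rd-order 2-dimensional tensor of Example 3.30 in Liu-Li-Vong:
\(a_{111}=1, a_{121}=1, a_{122}=-1, a_{222}=1, a_{211}=-1, a_{221}=1\), other entries 0. -/
noncomputable def Atensor3 : Fin 2 → (Fin 2 → Fin 2) → ℝ := fun i j =>
  if i = 0 then
    (if j 0 = 0 ∧ j 1 = 0 then 1
     else if j 0 = 1 ∧ j 1 = 0 then 1
     else if j 0 = 1 ∧ j 1 = 1 then -1 else 0)
  else
    (if j 0 = 1 ∧ j 1 = 1 then 1
     else if j 0 = 0 ∧ j 1 = 0 then -1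
     else if j 0 = 1 ∧ j 1 = 0 then 1 else 0)

theorem tApply_Atensor3_zero (x : Fin 2 → ℝ) :
    tApply Atensor3 x 0 = x 0 ^ 2 + x 0 * x 1 - x 1 ^ 2 := by
  unfold tApply
  rw [← (finTwoArrowEquiv (Fin 2)).symm.sum_comp, Fintype.sum_prod_type]
  simp [Atensor3, Fin.sum_univ_two, Fin.prod_univ_two]
  ring

theorem tApply_Atensor3_one (x : Fin 2 → ℝ) :
    tApply Atensor3 x 1 = x 1 ^ 2 + x 0 * x 1 - x 0 ^ 2 := by
  unfold tApply
  rw [← (finTwoArrowEquiv (Fin 2)).symm.sum_comp, Fintype.sum_prod_type]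
  simp [Atensor3, Fin.sum_univ_two, Fin.prod_univ_two]
  ring

/-- A real `2 × 2` P-matrix reverses the sign of no nonzero vector. -/
theorem eq_zero_of_two_by_two_P_matrix {a b c d u v : ℝ} (ha : 0 < a) (hd : 0 < d)
    (hdet : 0 < a * d - b * c) (hu : u * (a * u + b * v) ≤ 0)
    (hv : v * (c * u + d * v) ≤ 0) : u = 0 ∧ v = 0 := by
  rcases eq_or_ne u 0 with rfl | hu0
  · refine ⟨rfl, ?_⟩
    by_contra hv0
    have := mul_pos hd (sq_pos_of_ne_zero hv0)
    linarith
  rcases eq_or_ne v 0 with rfl | hv0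
  · have := mul_pos ha (sq_pos_of_ne_zero hu0)
    linarith
  have hu2 := sq_pos_of_ne_zero hu0
  have hv2 := sq_pos_of_ne_zero hv0
  have h1 : a * u ^ 2 ≤ -(b * u * v) := by linarith
  have h2 : d * v ^ 2 ≤ -(c * u * v) := by linarith
  have h := mul_le_mul h1 h2 (by positivity) ((by positivity : 0 ≤ a * u ^ 2).trans h1)
  have := mul_pos hdet (mul_pos hu2 hv2)
  linarith

theorem Atensor3_strong_strictly_semipositive : StrongStrictlySemiPositive Atensor3 := by
  intro q x y hx hy hxy
  by_contra! h
  have h0 := h 0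
  have h1 := h 1
  simp only [tApply_Atensor3_zero, tApply_Atensor3_one] at h0 h1
  have hs0 : 0 ≤ x 0 + y 0 := add_nonneg (hx 0) (hy 0)
  have hs1 : 0 ≤ x 1 + y 1 := add_nonneg (hx 1) (hy 1)
  have hs : 0 < (x 0 + y 0) + (x 1 + y 1) := by
    refine (add_nonneg hs0 hs1).lt_of_ne fun hzero => hxy ?_
    ext i
    fin_cases i <;> simp only [Fin.zero_eta, Fin.mk_one] <;>
      linarith [hx 0, hx 1, hy 0, hy 1]
  obtain ⟨hu, hv⟩ := eq_zero_of_two_by_two_P_matrix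
    (a := (x 0 + y 0) + (x 1 + y 1) / 2) (b := (x 0 + y 0) / 2 - (x 1 + y 1))
    (c := (x 1 + y 1) / 2 - (x 0 + y 0)) (d := (x 1 + y 1) + (x 0 + y 0) / 2)
    (u := x 0 - y 0) (v := x 1 - y 1) (by linarith) (by linarith)
    (by nlinarith [pow_pos hs 2, sq_nonneg ((x 0 + y 0) - (x 1 + y 1))])
    (by linarith) (by linarith)
  apply hxy
  ext i
  fin_cases i
  · exact sub_eq_zero.mp hu
  · exact sub_eq_zero.mp hv
end

section
/- Let A be the 4th-order 2-dimensional real tensor with entries a₁₁₁₁ = 1, a₁₂₂₂ = −1, a₁₁₂₂ = 1, a₂₂₂₂ = 1, a₂₁₁₁ = −1, a₂₂₁₁ = 1, and all other entries 0, so that for x ∈ ℝ², A x³ = (x₁³ − x₂³ + x₁x₂², x₂³ − x₁³ + x₁²x₂). Then A is strong strictly semi-positive: for every q ∈ ℝ², the map x ↦ A x³ + q is a P-function on ℝ₊². -/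
open Finset Filter

/-- The 4th-order 2-dimensional tensor of Example 4.2 in Bai-Huang-Wang:
\(a_{1111}=1, a_{1222}=-1, a_{1122}=1, a_{2222}=1, a_{2111}=-1, a_{2211}=1\),
other entries 0. -/
noncomputable def Atensor4 : Fin 2 → (Fin 3 → Fin 2) → ℝ := fun i j =>
  if i = 0 then
    (if j 0 = 0 ∧ j 1 = 0 ∧ j 2 = 0 then 1
     else if j 0 = 1 ∧ j 1 = 1 ∧ j 2 = 1 then -1
     else if j 0 = 0 ∧ j 1 = 1 ∧ j 2 = 1 then 1 else 0)
  else
    (if j 0 = 1 ∧ j 1 = 1 ∧ j 2 = 1 then 1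
     else if j 0 = 0 ∧ j 1 = 0 ∧ j 2 = 0 then -1
     else if j 0 = 1 ∧ j 1 = 0 ∧ j 2 = 0 then 1 else 0)

theorem sum_fin_three_fun {α M : Type*} [Fintype α] [AddCommMonoid M]
    (g : (Fin 3 → α) → M) : ∑ j, g j = ∑ a, ∑ b, ∑ c, g ![a, b, c] := by
  rw [← (Fin.consEquiv fun _ : Fin 3 => α).sum_comp, Fintype.sum_prod_type]
  refine Fintype.sum_congr _ _ fun a => ?_
  rw [← (Fin.consEquiv fun _ : Fin 2 => α).sum_comp, Fintype.sum_prod_type]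
  refine Fintype.sum_congr _ _ fun b => ?_
  rw [← (Fin.consEquiv fun _ : Fin 1 => α).sum_comp, Fintype.sum_prod_type]
  refine Fintype.sum_congr _ _ fun c => ?_
  rw [Fintype.sum_subsingleton _ ![]]
  rfl

theorem tApply_Atensor4_zero (x : Fin 2 → ℝ) :
    tApply Atensor4 x 0 = x 0 ^ 3 - x 1 ^ 3 + x 0 * x 1 ^ 2 := by
  simp [tApply, Atensor4, sum_fin_three_fun, Fin.prod_univ_three]
  ring

theorem tApply_Atensor4_one (x : Fin 2 → ℝ) :
    tApply Atensor4 x 1 = x 1 ^ 3 - x 0 ^ 3 + x 0 ^ 2 * x 1 := by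
  simp [tApply, Atensor4, sum_fin_three_fun, Fin.prod_univ_three]
  ring

/-- A two-by-two matrix with positive principal minors does not reverse the sign of a
nonzero vector. -/
theorem pos_or_pos_of_principal_minors_pos {m₁₁ m₁₂ m₂₁ m₂₂ u v : ℝ} (h₁ : 0 < m₁₁)
    (h₂ : 0 < m₂₂) (hdet : m₁₂ * m₂₁ < m₁₁ * m₂₂) (huv : u ≠ 0 ∨ v ≠ 0) :
    0 < u * (m₁₁ * u + m₁₂ * v) ∨ 0 < v * (m₂₁ * u + m₂₂ * v) := by
  by_contra! h
  obtain ⟨hu, hv⟩ := h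
  rcases eq_or_ne u 0 with rfl | hu0
  · have hv0 : v ≠ 0 := by simpa using huv
    have : 0 < m₂₂ * v ^ 2 := by positivity
    nlinarith
  rcases eq_or_ne v 0 with rfl | hv0
  · have : 0 < m₁₁ * u ^ 2 := by positivity
    nlinarith
  have hu' : m₁₁ * u ^ 2 ≤ -(u * v * m₁₂) := by linarith
  have hv' : m₂₂ * v ^ 2 ≤ -(u * v * m₂₁) := by linarith
  have hprod := mul_le_mul hu' hv' (by positivity) (le_trans (by positivity) hu')
  have hpos : 0 < u ^ 2 * v ^ 2 := by positivity
  nlinarith [mul_lt_mul_of_pos_left hdet hpos]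

theorem cubic_difference_pos {a b c d : ℝ} (ha : 0 ≤ a) (hb : 0 ≤ b) (hc : 0 ≤ c)
    (hd : 0 ≤ d) (hne : a - c ≠ 0 ∨ b - d ≠ 0) :
    0 < (a - c) * ((a ^ 3 - b ^ 3 + a * b ^ 2) - (c ^ 3 - d ^ 3 + c * d ^ 2)) ∨
      0 < (b - d) * ((b ^ 3 - a ^ 3 + a ^ 2 * b) - (d ^ 3 - c ^ 3 + c ^ 2 * d)) := by
  have hS : 0 ≤ a ^ 2 + a * c + c ^ 2 := by positivity
  have hT : 0 ≤ b ^ 2 + b * d + d ^ 2 := by positivity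
  have hp : 0 ≤ (a ^ 2 + c ^ 2) / 2 := by positivity
  have hr : 0 ≤ (b ^ 2 + d ^ 2) / 2 := by positivity
  have hw : 0 ≤ (a + c) * (b + d) / 2 := by positivity
  have hwST : (a + c) * (b + d) / 2 ≤
      (a ^ 2 + a * c + c ^ 2) + (b ^ 2 + b * d + d ^ 2) := by
    nlinarith [sq_nonneg (a + c - (b + d)), sq_nonneg (a - c), sq_nonneg (b - d)]
  have hSpos : (a - c ≠ 0) → 0 < a ^ 2 + a * c + c ^ 2 ∧ 0 < (a ^ 2 + c ^ 2) / 2 := by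
    intro h
    have := sq_pos_of_ne_zero h
    constructor <;> nlinarith [mul_nonneg ha hc]
  have hTpos : (b - d ≠ 0) → 0 < b ^ 2 + b * d + d ^ 2 ∧ 0 < (b ^ 2 + d ^ 2) / 2 := by
    intro h
    have := sq_pos_of_ne_zero h
    constructor <;> nlinarith [mul_nonneg hb hd]
  have e₁ : (a ^ 3 - b ^ 3 + a * b ^ 2) - (c ^ 3 - d ^ 3 + c * d ^ 2) =
      ((a ^ 2 + a * c + c ^ 2) + (b ^ 2 + d ^ 2) / 2) * (a - c) +
        ((a + c) * (b + d) / 2 - (b ^ 2 + b * d + d ^ 2)) * (b - d) := by ring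
  have e₂ : (b ^ 3 - a ^ 3 + a ^ 2 * b) - (d ^ 3 - c ^ 3 + c ^ 2 * d) =
      ((a + c) * (b + d) / 2 - (a ^ 2 + a * c + c ^ 2)) * (a - c) +
        ((b ^ 2 + b * d + d ^ 2) + (a ^ 2 + c ^ 2) / 2) * (b - d) := by ring
  rw [e₁, e₂]
  generalize a ^ 2 + a * c + c ^ 2 = S at *
  generalize b ^ 2 + b * d + d ^ 2 = T at *
  generalize (a ^ 2 + c ^ 2) / 2 = p at *
  generalize (b ^ 2 + d ^ 2) / 2 = r at *
  generalize (a + c) * (b + d) / 2 = w at *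
  have hdet : (w - T) * (w - S) < (S + r) * (T + p) := by
    have hpos : 0 < S * p + r * T := by
      rcases hne with h | h
      · have := hSpos h
        exact add_pos_of_pos_of_nonneg (mul_pos this.1 this.2) (mul_nonneg hr hT)
      · have := hTpos h
        exact add_pos_of_nonneg_of_pos (mul_nonneg hS hp) (mul_pos this.2 this.1)
    nlinarith [mul_le_mul_of_nonneg_left hwST hw, mul_nonneg hr hp]
  refine pos_or_pos_of_principal_minors_pos ?_ ?_ hdet hne
  · rcases hne with h | h
    · linarith [(hSpos h).1]
    · linarith [(hTpos h).2]
  · rcases hne with h | h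
    · linarith [(hSpos h).2]
    · linarith [(hTpos h).1]

theorem Atensor4_strong_strictly_semipositive : StrongStrictlySemiPositive Atensor4 := by
  intro q x y hx hy hxy
  have hne : x 0 - y 0 ≠ 0 ∨ x 1 - y 1 ≠ 0 := by
    by_contra! h
    exact hxy (funext (Fin.forall_fin_two.2 ⟨sub_eq_zero.1 h.1, sub_eq_zero.1 h.2⟩))
  simpa only [Fin.exists_fin_two, add_sub_add_right_eq_sub, tApply_Atensor4_zero,
    tApply_Atensor4_one] using cubic_difference_pos (hx 0) (hx 1) (hy 0) (hy 1) hne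
end
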